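/- arXiv:1412.4405 — 3 statements merged into one kernel-verified Lean document; each statement's English description precedes it below -/
import Mathlib

section
/- For every natural number d there exists δ > 0 such that the following holds: if p₁, …, p_k are distinct points in Euclidean space ℝ^d such that for any three distinct indices i, j, l the angle ∠p_i p_j p_l is at most π/2 + δ, then k ≤ 2^d. -/
open scoped RealInnerProductSpace

abbrev Euc (d : ℕ) := EuclideanSpace ℝ (Fin d)

open Filter Topology MeasureTheory Module
open scoped Pointwise

/-- A bounded function into a proper space converges along every ultrafilter. -/
lemma exists_tendsto_of_norm_le {N V : Type*} [NormedAddCommGroup V] [ProperSpace V]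
    (f : Ultrafilter N) {g : N → V} {C : ℝ} (hg : ∀ n, ‖g n‖ ≤ C) :
    ∃ x, Tendsto g f (𝓝 x) := by
  have hK := isCompact_closedBall (0 : V) C
  obtain ⟨x, -, hx⟩ := hK.ultrafilter_le_nhds (f.map g) (by
    rw [le_principal_iff]
    exact Filter.mem_of_superset (x := (Set.univ : Set N)) Filter.univ_mem
      (fun n _ => by simpa using hg n))
  exact ⟨x, hx⟩

/-- A point of the interior of a set lying in a closed half-space lies in the open one. -/
lemma inner_pos_of_mem_interior {V : Type*} [NormedAddCommGroup V] [InnerProductSpace ℝ V]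
    {K : Set V} {w y x : V} (hw : w ≠ 0) (hK : ∀ z ∈ K, 0 ≤ ⟪w, z - y⟫)
    (hx : x ∈ interior K) : 0 < ⟪w, x - y⟫ := by
  have hc : Continuous fun t : ℝ => x - t • w := by fun_prop
  have h0 : ∀ᶠ t : ℝ in 𝓝 0, x - t • w ∈ K := by
    apply hc.continuousAt.eventually_mem
    simpa using mem_interior_iff_mem_nhds.mp hx
  obtain ⟨t, ht, htK⟩ :=
    ((h0.filter_mono nhdsWithin_le_nhds).and self_mem_nhdsWithin : ∀ᶠ t : ℝ in 𝓝[>] 0, _).exists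
  have h1 := hK _ ht
  have h2 : ⟪w, x - t • w - y⟫ = ⟪w, x - y⟫ - t * ⟪w, w⟫ := by
    rw [show x - t • w - y = (x - y) - t • w by abel, inner_sub_right, inner_smul_right]
  have h3 : 0 < ⟪w, w⟫ := real_inner_self_pos.mpr hw
  have h4 : 0 < t := htK
  nlinarith [mul_pos h4 h3]

/-- The Danzer–Grünbaum bound for a spanning set without obtuse angles. -/
lemma card_le_two_pow_finrank_of_span_eq_top {G : Type*} [NormedAddCommGroup G]
    [InnerProductSpace ℝ G] [FiniteDimensional ℝ G] (F : Finset G) (h0 : (0 : G) ∈ F)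
    (hspan : Submodule.span ℝ (F : Set G) = ⊤)
    (hF : ∀ x ∈ F, ∀ y ∈ F, ∀ z ∈ F, 0 ≤ ⟪x - y, z - y⟫) :
    F.card ≤ 2 ^ finrank ℝ G := by
  borelize G
  set K := convexHull ℝ (F : Set G) with hKdef
  have hKconv : Convex ℝ K := convex_convexHull ℝ _
  set I := interior K with hI
  have hne : I.Nonempty := by
    rw [hI, hKdef, interior_convexHull_nonempty_iff_affineSpan_eq_top,
      AffineSubspace.affineSpan_eq_top_iff_vectorSpan_eq_top_of_nonempty ℝ G G ⟨0, h0⟩,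
      eq_top_iff, ← hspan, vectorSpan_eq_span_vsub_set_right ℝ (p := (0 : G)) h0]
    apply Submodule.span_mono
    intro x hx
    exact ⟨x, hx, by simp⟩
  have hIopen : IsOpen I := isOpen_interior
  have hpos : 0 < volume I := hIopen.measure_pos _ hne
  have hfin : volume I ≠ ⊤ := by
    have hb : Bornology.IsBounded I :=
      (isBounded_convexHull.mpr F.finite_toSet.isBounded).subset interior_subset
    exact hb.measure_lt_top.ne
  have hhalf : ∀ x ∈ F, ∀ y ∈ F, ∀ z ∈ K, 0 ≤ ⟪x - y, z - y⟫ := by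
    intro x hx y hy z hz
    have hc : Convex ℝ {z : G | ⟪x - y, y⟫ ≤ ⟪x - y, z⟫} :=
      convex_halfSpace_ge (innerₛₗ ℝ (x - y)).isLinear _
    have hsub : K ⊆ {z : G | ⟪x - y, y⟫ ≤ ⟪x - y, z⟫} :=
      convexHull_min (fun z hz => by
        have := hF x hx y hy z hz
        rw [inner_sub_right] at this
        simpa using this) hc
    have := hsub hz
    rw [inner_sub_right]
    simpa using this
  have hdisj : (F : Set G).PairwiseDisjoint fun x => (fun y => x + y) '' I := by
    intro x hx y hy hxy
    rw [Function.onFun, Set.disjoint_left]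
    rintro _ ⟨u, hu, rfl⟩ ⟨v, hv, huv⟩
    have h1 := inner_pos_of_mem_interior (sub_ne_zero.mpr hxy) (hhalf x hx y hy) hu
    have h2 := inner_pos_of_mem_interior (sub_ne_zero.mpr hxy.symm) (hhalf y hy x hx) hv
    have h3 : v = x + u - y := eq_sub_of_add_eq' huv
    have h4 : ⟪x - y, u - y⟫ + ⟪y - x, v - x⟫ = 0 := by
      rw [h3, ← neg_sub x y, inner_neg_left, ← sub_eq_add_neg, ← inner_sub_right,
        show u - y - (x + u - y - x) = 0 by abel, inner_zero_right]
    linarith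
  have hsub : (⋃ x ∈ F, (fun y => x + y) '' I) ⊆ (2 : ℝ) • I := by
    intro z hz
    simp only [Set.mem_iUnion] at hz
    obtain ⟨x, hx, u, hu, rfl⟩ := hz
    refine ⟨(2⁻¹ : ℝ) • x + (2⁻¹ : ℝ) • u, ?_, ?_⟩
    · exact hKconv.combo_self_interior_mem_interior (subset_convexHull ℝ _ hx) hu
        (by norm_num) (by norm_num) (by norm_num)
    · simp [smul_smul]
  have hm := measure_mono (μ := volume) hsub
  rw [measure_biUnion_finset hdisj
    (fun x _ => (isOpenMap_add_left x _ hIopen).measurableSet)] at hm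
  simp only [Set.image_add_left, measure_preimage_add, Finset.sum_const,
    Measure.addHaar_smul, nsmul_eq_mul] at hm
  rw [ENNReal.mul_le_mul_iff_left hpos.ne' hfin, abs_of_pos (by positivity),
    ENNReal.ofReal_pow (by norm_num)] at hm
  norm_num at hm
  exact_mod_cast hm

lemma card_le_two_pow_finrank_span {G : Type*} [NormedAddCommGroup G]
    [InnerProductSpace ℝ G] [FiniteDimensional ℝ G] (F : Finset G) (h0 : (0 : G) ∈ F)
    (hF : ∀ x ∈ F, ∀ y ∈ F, ∀ z ∈ F, 0 ≤ ⟪x - y, z - y⟫) :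
    F.card ≤ 2 ^ finrank ℝ (Submodule.span ℝ (F : Set G)) := by
  set E := Submodule.span ℝ (F : Set G) with hE
  let F' : Finset E := F.preimage (fun x : E => (x : G)) Subtype.val_injective.injOn
  have hcard : F'.card = F.card := by
    classical
    rw [Finset.card_preimage, Finset.filter_true_of_mem]
    intro x hx
    exact ⟨⟨x, Submodule.subset_span hx⟩, rfl⟩
  rw [← hcard]
  refine card_le_two_pow_finrank_of_span_eq_top F' (by simpa [F'] using h0) ?_ ?_
  · rw [Finset.coe_preimage]
    exact Submodule.span_span_coe_preimage
  · intro x hx y hy z hz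
    exact hF x (Finset.mem_preimage.mp hx) y (Finset.mem_preimage.mp hy) z
      (Finset.mem_preimage.mp hz)

/-- If the limiting directions between the points of a family of configurations make no obtuse
angle and lie in a subspace `W`, then there are at most `2 ^ dim W` points. -/
lemma card_le_two_pow_finrank_of_tendsto {N ι V : Type*} [NormedAddCommGroup V]
    [InnerProductSpace ℝ V] [FiniteDimensional ℝ V] (f : Ultrafilter N)
    (p : N → ι → V) (hp : ∀ n, Function.Injective (p n)) (U : ι → ι → V)
    (hU : ∀ i j, i ≠ j →
      Tendsto (fun n => ‖p n j - p n i‖⁻¹ • (p n j - p n i)) f (𝓝 (U i j)))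
    (hpos : ∀ i j l, i ≠ j → i ≠ l → 0 ≤ ⟪U i j, U i l⟫)
    (S : Finset ι) (W : Submodule ℝ V) (hW : ∀ i ∈ S, ∀ j ∈ S, i ≠ j → U i j ∈ W) :
    S.card ≤ 2 ^ finrank ℝ W := by
  classical
  induction S using Finset.strongInduction generalizing W with
  | H S ih =>
  by_cases hS : S.card ≤ 1
  · exact hS.trans Nat.one_le_two_pow
  obtain ⟨a, ha, b, hb, hab⟩ := Finset.one_lt_card.mp (not_le.mp hS)
  let D : N → ℝ := fun n => ∑ i ∈ S, ‖p n i - p n a‖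
  have hle : ∀ n, ∀ i ∈ S, ‖p n i - p n a‖ ≤ D n := fun n i hi =>
    Finset.single_le_sum (f := fun i => ‖p n i - p n a‖) (fun _ _ => norm_nonneg _) hi
  have hD : ∀ n, 0 < D n := fun n =>
    (norm_pos_iff.mpr (sub_ne_zero.mpr ((hp n).ne hab.symm))).trans_le (hle n b hb)
  have hlim : ∀ i, ∃ x, i ∈ S → Tendsto (fun n => (D n)⁻¹ • (p n i - p n a)) f (𝓝 x) := by
    intro i
    by_cases hi : i ∈ S
    · obtain ⟨x, hx⟩ := exists_tendsto_of_norm_le (C := 1) f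
        (g := fun n => (D n)⁻¹ • (p n i - p n a)) (fun n => by
          rw [norm_smul, norm_inv, Real.norm_of_nonneg (hD n).le, inv_mul_le_one₀ (hD n)]
          exact hle n i hi)
      exact ⟨x, fun _ => hx⟩
    · exact ⟨0, fun h => absurd h hi⟩
  choose Q hQ using hlim
  have hQa : Q a = 0 :=
    tendsto_nhds_unique (hQ a ha) (by simp)
  have hsum : ∑ i ∈ S, ‖Q i‖ = 1 := by
    have h1 : Tendsto (fun n => ∑ i ∈ S, ‖(D n)⁻¹ • (p n i - p n a)‖) f
        (𝓝 (∑ i ∈ S, ‖Q i‖)) := tendsto_finsetSum _ fun i hi => (hQ i hi).norm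
    refine tendsto_nhds_unique h1 (tendsto_const_nhds.congr fun n => ?_)
    simp only [norm_smul, norm_inv, Real.norm_of_nonneg (hD n).le, ← Finset.mul_sum]
    exact (inv_mul_cancel₀ (hD n).ne').symm
  have hQdiff : ∀ i ∈ S, ∀ j ∈ S, i ≠ j → ∃ c : ℝ, 0 ≤ c ∧ Q j - Q i = c • U i j := by
    intro i hi j hj hij
    have h1 : Tendsto (fun n => (D n)⁻¹ • (p n j - p n i)) f (𝓝 (Q j - Q i)) :=
      ((hQ j hj).sub (hQ i hi)).congr fun n => by rw [← smul_sub, sub_sub_sub_cancel_right]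
    refine ⟨‖Q j - Q i‖, norm_nonneg _, tendsto_nhds_unique h1 ?_⟩
    refine (h1.norm.smul (hU i j hij)).congr fun n => ?_
    have hne : ‖p n j - p n i‖ ≠ 0 := norm_ne_zero_iff.mpr (sub_ne_zero.mpr ((hp n).ne hij.symm))
    rw [norm_smul, norm_inv, Real.norm_of_nonneg (hD n).le, smul_smul, mul_assoc,
      mul_inv_cancel₀ hne, mul_one]
  have hUneg : ∀ i j, i ≠ j → U j i = - U i j := by
    intro i j hij
    refine tendsto_nhds_unique (hU j i hij.symm) ((hU i j hij).neg.congr fun n => ?_)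
    rw [norm_sub_rev, ← smul_neg, neg_sub]
  have hUQ : ∀ i ∈ S, ∀ j, i ≠ j → ∀ m ∈ S, 0 ≤ ⟪U i j, Q m - Q i⟫ := by
    intro i hi j hij m hm
    by_cases him : i = m
    · simp [him]
    · obtain ⟨c, hc, h⟩ := hQdiff i hi m hm him
      rw [h, inner_smul_right]
      exact mul_nonneg hc (hpos i j m hij him)
  set E := Submodule.span ℝ ((S.image Q : Finset V) : Set V) with hE
  have hEW : E ≤ W := by
    rw [hE, Submodule.span_le]
    intro x hx
    obtain ⟨i, hi, rfl⟩ := Finset.mem_image.mp hx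
    by_cases hai : a = i
    · rw [← hai, hQa]; exact W.zero_mem
    · obtain ⟨c, -, h⟩ := hQdiff a ha i hi hai
      rw [hQa, sub_zero] at h
      rw [h]
      exact W.smul_mem c (hW a ha i hi hai)
  have himage : (S.image Q).card ≤ 2 ^ finrank ℝ E := by
    refine card_le_two_pow_finrank_span _ (Finset.mem_image.mpr ⟨a, ha, hQa⟩) ?_
    intro x hx y hy z hz
    obtain ⟨i, hi, rfl⟩ := Finset.mem_image.mp hx
    obtain ⟨j, hj, rfl⟩ := Finset.mem_image.mp hy
    obtain ⟨m, hm, rfl⟩ := Finset.mem_image.mp hz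
    by_cases hji : j = i
    · simp [hji]
    · obtain ⟨c, hc, h⟩ := hQdiff j hj i hi hji
      rw [h, real_inner_smul_left]
      exact mul_nonneg hc (hUQ j hj i hji m hm)
  have hfiber : ∀ x ∈ S.image Q,
      (S.filter fun i => Q i = x).card ≤ 2 ^ finrank ℝ (Eᗮ ⊓ W : Submodule ℝ V) := by
    intro x _
    apply ih
    · refine Finset.filter_ssubset.mpr ?_
      by_contra! hall
      have hz : ∀ i ∈ S, Q i = 0 := fun i hi => by rw [hall i hi, ← hall a ha, hQa]
      rw [Finset.sum_eq_zero fun i hi => by rw [hz i hi, norm_zero]] at hsum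
      exact zero_ne_one hsum
    · intro i hi j hj hij
      obtain ⟨hi, hix⟩ := Finset.mem_filter.mp hi
      obtain ⟨hj, hjx⟩ := Finset.mem_filter.mp hj
      refine ⟨?_, hW i hi j hj hij⟩
      have horth : ∀ m ∈ S, ⟪U i j, Q m - Q i⟫ = 0 := by
        intro m hm
        have h1 := hUQ i hi j hij m hm
        have h2 := hUQ j hj i hij.symm m hm
        rw [hUneg i j hij, inner_neg_left, hjx, ← hix] at h2
        linarith
      have hi0 : ⟪U i j, Q i⟫ = 0 := by
        simpa [hQa] using horth a ha
      refine (Submodule.mem_orthogonal' E _).mpr ?_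
      intro u hu
      induction hu using Submodule.span_induction with
      | mem y hy =>
        obtain ⟨m, hm, rfl⟩ := Finset.mem_image.mp hy
        have := horth m hm
        rwa [inner_sub_right, hi0, sub_zero] at this
      | zero => exact inner_zero_right _
      | add y z _ _ hy hz => rw [inner_add_right, hy, hz, add_zero]
      | smul c y _ hy => rw [inner_smul_right, hy, mul_zero]
  calc S.card = ∑ x ∈ S.image Q, (S.filter fun i => Q i = x).card :=
        Finset.card_eq_sum_card_image Q S
    _ ≤ ∑ x ∈ S.image Q, 2 ^ finrank ℝ (Eᗮ ⊓ W : Submodule ℝ V) := Finset.sum_le_sum hfiber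
    _ = (S.image Q).card * 2 ^ finrank ℝ (Eᗮ ⊓ W : Submodule ℝ V) := by
        rw [Finset.sum_const, smul_eq_mul]
    _ ≤ 2 ^ finrank ℝ E * 2 ^ finrank ℝ (Eᗮ ⊓ W : Submodule ℝ V) := by gcongr
    _ = 2 ^ finrank ℝ W := by
        rw [← pow_add, Submodule.finrank_add_inf_finrank_orthogonal hEW]

theorem stmt7 (d : ℕ) :
    ∃ δ : ℝ, 0 < δ ∧
      ∀ (k : ℕ) (p : Fin k → Euc d), Function.Injective p →
        (∀ i j l : Fin k, i ≠ j → j ≠ l → i ≠ l →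
          EuclideanGeometry.angle (p i) (p j) (p l) ≤ Real.pi / 2 + δ) →
        k ≤ 2 ^ d := by
  by_contra! hcon
  have hex : ∀ n : ℕ, ∃ q : Fin (2 ^ d + 1) → Euc d, Function.Injective q ∧
      ∀ i j l, i ≠ j → j ≠ l → i ≠ l →
        EuclideanGeometry.angle (q i) (q j) (q l) ≤ Real.pi / 2 + 1 / ((n : ℝ) + 1) := by
    intro n
    obtain ⟨k, p, hp, hang, hk⟩ := hcon (1 / ((n : ℝ) + 1)) (by positivity)
    have hinj := Fin.castLE_injective (Nat.succ_le_of_lt hk)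
    exact ⟨p ∘ Fin.castLE (Nat.succ_le_of_lt hk), hp.comp hinj, fun i j l hij hjl hil =>
      hang _ _ _ (hinj.ne hij) (hinj.ne hjl) (hinj.ne hil)⟩
  choose p hp hang using hex
  let f : Ultrafilter ℕ := hyperfilter ℕ
  have hf : (f : Filter ℕ) ≤ atTop := Nat.hyperfilter_le_atTop
  have hlim : ∀ i j, ∃ x, Tendsto (fun n => ‖p n j - p n i‖⁻¹ • (p n j - p n i)) f (𝓝 x) :=
    fun i j => exists_tendsto_of_norm_le (C := 1) f fun n => by
      rw [norm_smul, norm_inv, norm_norm]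
      exact inv_mul_le_one
  choose U hU using hlim
  have hpos : ∀ i j l, i ≠ j → i ≠ l → 0 ≤ ⟪U i j, U i l⟫ := by
    intro i j l hij hil
    by_cases hjl : j = l
    · rw [hjl]; exact real_inner_self_nonneg
    have hcos : Tendsto (fun n : ℕ => Real.cos (Real.pi / 2 + 1 / ((n : ℝ) + 1))) f (𝓝 0) := by
      have h := (tendsto_one_div_add_atTop_nhds_zero_nat (𝕜 := ℝ)).const_add (Real.pi / 2)
      have h' := ((Real.continuous_cos.tendsto _).comp h).mono_left hf
      simpa [Function.comp_def] using h'
    refine le_of_tendsto_of_tendsto' hcos ((hU i j).inner (hU i l)) fun n => ?_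
    have h1 : (1 : ℝ) / ((n : ℝ) + 1) ≤ 1 := by
      rw [div_le_one (by positivity)]; linarith [(Nat.cast_nonneg n : (0 : ℝ) ≤ n)]
    have h2 := Real.cos_le_cos_of_nonneg_of_le_pi (EuclideanGeometry.angle_nonneg _ _ _)
      (by linarith [Real.pi_gt_three]) (hang n j i l hij.symm hil hjl)
    refine h2.trans_eq ?_
    rw [EuclideanGeometry.angle, InnerProductGeometry.cos_angle, real_inner_smul_left,
      inner_smul_right, vsub_eq_sub, vsub_eq_sub, div_eq_mul_inv, mul_inv]
    ring
  have hcard := card_le_two_pow_finrank_of_tendsto f p hp U (fun i j _ => hU i j) hpos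
    Finset.univ ⊤ (fun _ _ _ _ _ => Submodule.mem_top)
  simp at hcard
end

section
/- For every natural number k ≥ 1, every dimension d, and every ε with 0 < ε < 1, there exists N ∈ ℕ such that the following holds. Let V be a finite set of points in Euclidean space ℝ^d and let V₁, …, V_k be pairwise disjoint subsets of V, each of cardinality N, such that any two points lying in different subsets form a double-normal pair of V. Then there exist a permutation σ of {1, …, k} and, for each i ∈ {1, …, k}, four distinct points A_i, a_i, b_i, C_i ∈ V_{σ(i)} such that: (1) ∠A_i a_i b_i ≥ π − ε and ∠a_i b_i C_i ≥ π − ε; (2) ‖A_{i+1} − C_{i+1}‖ ≤ ε·‖A_i − C_i‖ for every i ∈ {1, …, k−1}; (3) ‖A_i − b_i‖ ≥ (1/2)·‖A_i − C_i‖; and (4) ‖a_i − b_i‖ ≤ ε·‖A_i − b_i‖. -/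
open scoped RealInnerProductSpace

/-- `p, q` form a double-normal pair of the finite point set `V`. -/
def IsDoubleNormalPair {d : ℕ} (V : Finset (Euc d)) (p q : Euc d) : Prop :=
  p ≠ q ∧ p ∈ V ∧ q ∈ V ∧
    ∀ x ∈ V, 0 ≤ ⟪x - p, q - p⟫ ∧ 0 ≤ ⟪x - q, p - q⟫

/-- `p, q` form a strict double-normal pair of the finite point set `V`. -/
def IsStrictDoubleNormalPair {d : ℕ} (V : Finset (Euc d)) (p q : Euc d) : Prop :=
  p ≠ q ∧ p ∈ V ∧ q ∈ V ∧
    ∀ x ∈ V, x ≠ p → x ≠ q → 0 < ⟪x - p, q - p⟫ ∧ 0 < ⟪x - q, p - q⟫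

/-- Some finite set in `ℝ^d` contains the complete `k`-partite graph `K_k(r)`
in its double-normal graph. -/
def ContainsDNMultipartite (d k r : ℕ) : Prop :=
  ∃ (V : Finset (Euc d)) (P : Fin k → Finset (Euc d)),
    (∀ i, P i ⊆ V) ∧ (∀ i, (P i).card = r) ∧
    (∀ i j, i ≠ j → Disjoint (P i) (P j)) ∧
    (∀ i j, i ≠ j → ∀ p ∈ P i, ∀ q ∈ P j, IsDoubleNormalPair V p q)

/-- Some finite set in `ℝ^d` contains the complete `k`-partite graph `K_k(r)`
in its strict double-normal graph. -/
def ContainsStrictDNMultipartite (d k r : ℕ) : Prop :=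
  ∃ (V : Finset (Euc d)) (P : Fin k → Finset (Euc d)),
    (∀ i, P i ⊆ V) ∧ (∀ i, (P i).card = r) ∧
    (∀ i j, i ≠ j → Disjoint (P i) (P j)) ∧
    (∀ i j, i ≠ j → ∀ p ∈ P i, ∀ q ∈ P j, IsStrictDoubleNormalPair V p q)

/-- If any two distinct elements are related by one of finitely many relations, then every large
finite set contains a monochromatic path of length `m`. -/
theorem exists_monochromatic_path {α ι : Type*} [Finite ι] (R : ι → α → α → Prop)
    (hR : ∀ x y, x ≠ y → ∃ i, R i x y) (m : ℕ) :
    ∃ N : ℕ, ∀ V : Finset α, N ≤ V.card → ∃ (i : ι) (f : ℕ → α),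
      (∀ n ≤ m, f n ∈ V) ∧ ∀ n < m, R i (f n) (f (n + 1)) := by
  classical
  have := Fintype.ofFinite ι
  refine ⟨Fintype.card (ι → Fin m → Prop) + 1, fun V hV => ?_⟩
  let L : ι → ℕ → α → Prop := fun i n x => ∃ f : ℕ → α, f n = x ∧
    (∀ l ≤ n, f l ∈ V) ∧ ∀ l < n, R i (f l) (f (l + 1))
  have hstep : ∀ i n x y, L i n x → y ∈ V → R i x y → L i (n + 1) y := by
    rintro i n x y ⟨f, rfl, hfV, hf⟩ hy hxy
    refine ⟨fun l => if l ≤ n then f l else y, by simp, fun l _ => ?_, fun l hl => ?_⟩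
    · by_cases h : l ≤ n
      · simpa [h] using hfV l h
      · simpa [h] using hy
    · rcases Nat.lt_succ_iff_lt_or_eq.mp hl with h | rfl
      · simpa [h.le, Nat.succ_le_of_lt h] using hf l h
      · simpa using hxy
  obtain ⟨x, hx, y, hy, hne, hxy⟩ := Finset.exists_ne_map_eq_of_card_lt_of_maps_to
    (s := V) (t := (Finset.univ : Finset (ι → Fin m → Prop)))
    (f := fun x i n => L i n x) (by rw [Finset.card_univ]; omega) (fun _ _ => by simp)
  obtain ⟨i, hi⟩ := hR x y hne
  have hL : ∀ n ≤ m, L i n y := by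
    intro n
    induction n with
    | zero => exact fun _ => ⟨fun _ => y, rfl, fun _ _ => hy, fun _ h => absurd h (by omega)⟩
    | succ n ih =>
      intro hn
      have h := congrFun (congrFun hxy i) ⟨n, hn⟩
      simp only [eq_iff_iff] at h
      exact hstep i n x y (h.mpr (ih (by omega))) hy hi
  obtain ⟨f, -, h⟩ := hL m le_rfl
  exact ⟨i, f, h⟩

/-- An almost collinear quadruple of points of `W` whose middle points are close together. -/
def IsFlatQuadruple {d : ℕ} (ε : ℝ) (W : Finset (Euc d))
    (q : Euc d × Euc d × Euc d × Euc d) : Prop :=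
  (q.1 ∈ W ∧ q.2.1 ∈ W ∧ q.2.2.1 ∈ W ∧ q.2.2.2 ∈ W) ∧
  (q.1 ≠ q.2.1 ∧ q.1 ≠ q.2.2.1 ∧ q.1 ≠ q.2.2.2 ∧ q.2.1 ≠ q.2.2.1 ∧ q.2.1 ≠ q.2.2.2 ∧
    q.2.2.1 ≠ q.2.2.2) ∧
  (Real.pi - ε ≤ EuclideanGeometry.angle q.1 q.2.1 q.2.2.1 ∧
    Real.pi - ε ≤ EuclideanGeometry.angle q.2.1 q.2.2.1 q.2.2.2) ∧
  (1 / 2) * dist q.1 q.2.2.2 ≤ dist q.1 q.2.2.1 ∧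
  dist q.2.1 q.2.2.1 ≤ ε * dist q.1 q.2.2.1

theorem IsFlatQuadruple.mono {d : ℕ} {ε : ℝ} {W W' : Finset (Euc d)}
    {q : Euc d × Euc d × Euc d × Euc d} (h : IsFlatQuadruple ε W q) (hW : W ⊆ W') :
    IsFlatQuadruple ε W' q :=
  ⟨⟨hW h.1.1, hW h.1.2.1, hW h.1.2.2.1, hW h.1.2.2.2⟩, h.2⟩

theorem exists_finite_unit_cover (d : ℕ) (r : ℝ) (hr : 0 < r) :
    ∃ T : Finset (Euc d), ∀ v : Euc d, ‖v‖ ≤ 1 → ∃ t ∈ T, dist v t < r := by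
  obtain ⟨T, -, hT, hcov⟩ :=
    (isCompact_closedBall (0 : Euc d) 1).finite_cover_balls (e := r) hr
  refine ⟨hT.toFinset, fun v hv => ?_⟩
  have := hcov (show v ∈ Metric.closedBall 0 1 by simpa using hv)
  simpa using this

/-- Finitely many narrow circular cones cover the space. -/
theorem exists_finite_cone_cover (d : ℕ) (c : ℝ) (hc : c < 1) :
    ∃ U : Finset (Euc d), (∀ u ∈ U, ‖u‖ = 1) ∧
      ∀ v : Euc d, v ≠ 0 → ∃ u ∈ U, c * ‖v‖ ≤ ⟪v, u⟫ := by
  obtain ⟨U, hU, hfin, hcov⟩ :=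
    (isCompact_sphere (0 : Euc d) 1).finite_cover_balls (e := 1 - c) (by linarith)
  refine ⟨hfin.toFinset, fun u hu => by simpa using hU (hfin.mem_toFinset.mp hu),
    fun v hv => ?_⟩
  have hv' : 0 < ‖v‖ := norm_pos_iff.mpr hv
  have hw : ‖‖v‖⁻¹ • v‖ = 1 := by rw [norm_smul]; simp [hv'.ne']
  have := hcov (show ‖v‖⁻¹ • v ∈ Metric.sphere 0 1 by simpa using hw)
  simp only [Set.mem_iUnion, Metric.mem_ball, exists_prop] at this
  obtain ⟨u, hu, hdist⟩ := this
  refine ⟨u, hfin.mem_toFinset.mpr hu, ?_⟩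
  have h1 : ⟪‖v‖⁻¹ • v, ‖v‖⁻¹ • v - u⟫ ≤ 1 - c := by
    refine (real_inner_le_norm _ _).trans ?_
    rw [hw, one_mul, ← dist_eq_norm]
    exact hdist.le
  rw [inner_sub_right, real_inner_self_eq_norm_sq, hw, real_inner_smul_left] at h1
  have h2 : c ≤ ‖v‖⁻¹ * ⟪v, u⟫ := by linarith
  calc c * ‖v‖ ≤ (‖v‖⁻¹ * ⟪v, u⟫) * ‖v‖ := by gcongr
    _ = ⟪v, u⟫ := by field_simp

theorem angle_le_of_mem_cone {d : ℕ} {ε : ℝ} (hε0 : 0 < ε) (hε1 : ε < 1) {u v w : Euc d}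
    (hu : ‖u‖ = 1) (hv0 : v ≠ 0) (hw0 : w ≠ 0) (hv : Real.cos (ε / 2) * ‖v‖ ≤ ⟪v, u⟫)
    (hw : Real.cos (ε / 2) * ‖w‖ ≤ ⟪w, u⟫) : InnerProductGeometry.angle v w ≤ ε := by
  have key : ∀ z : Euc d, z ≠ 0 → Real.cos (ε / 2) * ‖z‖ ≤ ⟪z, u⟫ →
      InnerProductGeometry.angle z u ≤ ε / 2 := by
    intro z hz0 hz
    have hz' : 0 < ‖z‖ := norm_pos_iff.mpr hz0
    rw [InnerProductGeometry.angle, hu, mul_one,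
      ← Real.arccos_cos (x := ε / 2) (by linarith) (by linarith [Real.pi_gt_three])]
    exact Real.arccos_le_arccos ((le_div_iff₀ hz').mpr hz)
  have h := InnerProductGeometry.angle_le_angle_add_angle v u w
  have h1 := key v hv0 hv
  have h2 := key w hw0 hw
  rw [InnerProductGeometry.angle_comm] at h2
  linarith

theorem pi_sub_le_angle_of_mem_cone {d : ℕ} {ε : ℝ} (hε0 : 0 < ε) (hε1 : ε < 1)
    {u x y z : Euc d} (hu : ‖u‖ = 1) (hxy : y - x ≠ 0) (hyz : z - y ≠ 0)
    (h1 : Real.cos (ε / 2) * ‖y - x‖ ≤ ⟪y - x, u⟫)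
    (h2 : Real.cos (ε / 2) * ‖z - y‖ ≤ ⟪z - y, u⟫) :
    Real.pi - ε ≤ EuclideanGeometry.angle x y z := by
  have h := angle_le_of_mem_cone hε0 hε1 hu hxy hyz h1 h2
  rw [EuclideanGeometry.angle, vsub_eq_sub, vsub_eq_sub, ← neg_sub y x,
    InnerProductGeometry.angle_neg_left]
  linarith

/-- Every large finite set of points contains an almost collinear quadruple. -/
theorem exists_isFlatQuadruple (d : ℕ) (ε : ℝ) (hε0 : 0 < ε) (hε1 : ε < 1) :
    ∃ N : ℕ, ∀ W : Finset (Euc d), N ≤ W.card → ∃ q, IsFlatQuadruple ε W q := by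
  set c := Real.cos (ε / 2) with hc
  have hc1 : c < 1 := by
    rw [hc, ← Real.cos_zero]
    exact Real.cos_lt_cos_of_nonneg_of_le_pi le_rfl (by linarith [Real.pi_gt_three])
      (by linarith)
  have hc2 : 1 / 2 ≤ c := by
    have := Real.one_sub_sq_div_two_le_cos (x := ε / 2)
    nlinarith
  obtain ⟨U, hU, hcov⟩ := exists_finite_cone_cover d c hc1
  obtain ⟨m, hm⟩ := exists_nat_gt (4 / ε)
  have hm0 : 1 ≤ m := by
    have : (0 : ℝ) < m := lt_trans (by positivity) hm
    exact_mod_cast this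
  obtain ⟨N, hN⟩ := exists_monochromatic_path
    (fun (u : U) (x y : Euc d) => x ≠ y ∧ c * ‖y - x‖ ≤ ⟪y - x, (u : Euc d)⟫)
    (fun x y hxy => by
      obtain ⟨u, hu, h⟩ := hcov (y - x) (sub_ne_zero.mpr hxy.symm)
      exact ⟨⟨u, hu⟩, hxy, h⟩) (m + 2)
  refine ⟨N, fun W hW => ?_⟩
  obtain ⟨⟨u, huU⟩, f, hfW, hf⟩ := hN W hW
  have hu := hU u huU
  dsimp only at hf
  have hpos : ∀ n < m + 2, 0 < ⟪f (n + 1) - f n, u⟫ := fun n hn => by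
    have h1 : 0 < ‖f (n + 1) - f n‖ := norm_pos_iff.mpr (sub_ne_zero.mpr (hf n hn).1.symm)
    have h2 := (hf n hn).2
    nlinarith
  have hlt : ∀ i j, i < j → j ≤ m + 2 → 0 < ⟪f j - f i, u⟫ ∧ c * ‖f j - f i‖ ≤ ⟪f j - f i, u⟫ := by
    intro i j hij
    induction j, hij using Nat.le_induction with
    | base => exact fun h => ⟨hpos i (by omega), (hf i (by omega)).2⟩
    | succ j hij ih =>
      intro hj
      have h1 := ih (by omega)
      have h2 := hpos j (by omega)
      have h3 := (hf j (by omega)).2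
      have h4 := norm_add_le (f (j + 1) - f j) (f j - f i)
      rw [← sub_add_sub_cancel (f (j + 1)) (f j) (f i), inner_add_left]
      refine ⟨by linarith, ?_⟩
      nlinarith
  have hne : ∀ i j, i < j → j ≤ m + 2 → f j - f i ≠ 0 := fun i j h1 h2 h0 => by
    have := (hlt i j h1 h2).1
    rw [h0, inner_zero_left] at this
    exact lt_irrefl _ this
  have hne' : ∀ i j, i < j → j ≤ m + 2 → f i ≠ f j := fun i j h1 h2 h0 =>
    hne i j h1 h2 (by rw [h0, sub_self])
  set D := dist (f 0) (f (m + 2)) with hD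
  have hDn : D = ‖f (m + 2) - f 0‖ := by rw [hD, dist_comm, dist_eq_norm]
  obtain ⟨l, hl, hgap⟩ : ∃ l < m, dist (f (l + 1)) (f (l + 2)) ≤ ε / 2 * D := by
    by_contra! hcon
    have hsum : ∑ l ∈ Finset.range m, ⟪f (l + 2) - f (l + 1), u⟫ = ⟪f (m + 1) - f 1, u⟫ := by
      rw [← sum_inner, Finset.sum_range_sub (fun l => f (l + 1))]
    have hlow : ∑ l ∈ Finset.range m, c * (ε / 2 * D) ≤
        ∑ l ∈ Finset.range m, ⟪f (l + 2) - f (l + 1), u⟫ := by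
      refine Finset.sum_le_sum fun l hl => ?_
      have hl' := Finset.mem_range.mp hl
      have h1 := (hf (l + 1) (by omega)).2
      have h2 := hcon l hl'
      rw [dist_comm, dist_eq_norm] at h2
      refine le_trans ?_ h1
      gcongr
    rw [hsum, Finset.sum_const, Finset.card_range, nsmul_eq_mul] at hlow
    have h3 : ⟪f (m + 2) - f 0, u⟫ ≤ D := by
      have := real_inner_le_norm (f (m + 2) - f 0) u
      rwa [hu, mul_one, ← hDn] at this
    have h4 : ⟪f (m + 2) - f 0, u⟫ = ⟪f (m + 2) - f (m + 1), u⟫ + ⟪f (m + 1) - f 1, u⟫ +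
        ⟪f 1 - f 0, u⟫ := by
      rw [← inner_add_left, ← inner_add_left]
      congr 1
      abel
    have h5 := hpos (m + 1) (by omega)
    have h6 := hpos 0 (by omega)
    have hDpos : 0 < D := hDn ▸ norm_pos_iff.mpr (hne 0 (m + 2) (by omega) le_rfl)
    have h7 : 4 < m * ε := (div_lt_iff₀ hε0).mp hm
    have h8 : 1 ≤ m * (c * (ε / 2)) := by nlinarith
    have h9 : D ≤ m * (c * (ε / 2 * D)) := by nlinarith
    norm_num at h5 h6
    linarith
  have hang : ∀ i j k, i < j → j < k → k ≤ m + 2 →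
      Real.pi - ε ≤ EuclideanGeometry.angle (f i) (f j) (f k) := fun i j k hij hjk hk =>
    pi_sub_le_angle_of_mem_cone hε0 hε1 hu (hne i j hij (by omega)) (hne j k hjk hk)
      (hlt i j hij (by omega)).2 (hlt j k hjk hk).2
  have m0 := hfW 0 (by omega)
  have m1 := hfW (l + 1) (by omega)
  have m2 := hfW (l + 2) (by omega)
  have m3 := hfW (m + 2) le_rfl
  have n01 := hne' 0 (l + 1) (by omega) (by omega)
  have n02 := hne' 0 (l + 2) (by omega) (by omega)
  have n03 := hne' 0 (m + 2) (by omega) (by omega)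
  have n12 := hne' (l + 1) (l + 2) (by omega) (by omega)
  have n13 := hne' (l + 1) (m + 2) (by omega) (by omega)
  have n23 := hne' (l + 2) (m + 2) (by omega) (by omega)
  have a012 := hang 0 (l + 1) (l + 2) (by omega) (by omega) (by omega)
  have a123 := hang (l + 1) (l + 2) (m + 2) (by omega) (by omega) (by omega)
  by_cases hhalf : 1 / 2 * D ≤ dist (f 0) (f (l + 2))
  · refine ⟨(f 0, f (l + 1), f (l + 2), f (m + 2)), ⟨m0, m1, m2, m3⟩,
      ⟨n01, n02, n03, n12, n13, n23⟩, ⟨a012, a123⟩, hhalf, ?_⟩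
    dsimp only
    nlinarith
  · have hhalf' : 1 / 2 * D ≤ dist (f (m + 2)) (f (l + 1)) := by
      have htri := dist_triangle (f 0) (f (l + 2)) (f (m + 2))
      have hang' := angle_le_of_mem_cone hε0 hε1 hu (hne (l + 2) (m + 2) (by omega) le_rfl)
        (hne (l + 1) (l + 2) (by omega) (by omega)) (hlt (l + 2) (m + 2) (by omega) le_rfl).2
        (hlt (l + 1) (l + 2) (by omega) (by omega)).2
      have hinner : 0 ≤ ⟪f (m + 2) - f (l + 2), f (l + 2) - f (l + 1)⟫ := by
        rw [← InnerProductGeometry.cos_angle_mul_norm_mul_norm]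
        have := InnerProductGeometry.angle_nonneg (f (m + 2) - f (l + 2)) (f (l + 2) - f (l + 1))
        refine mul_nonneg (Real.cos_nonneg_of_mem_Icc ⟨?_, ?_⟩) (by positivity) <;>
          linarith [Real.pi_gt_three]
      have hsq := norm_add_sq_real (f (m + 2) - f (l + 2)) (f (l + 2) - f (l + 1))
      rw [sub_add_sub_cancel] at hsq
      have hle : ‖f (m + 2) - f (l + 2)‖ ≤ ‖f (m + 2) - f (l + 1)‖ :=
        (sq_le_sq₀ (norm_nonneg _) (norm_nonneg _)).mp
          (by nlinarith [sq_nonneg ‖f (l + 2) - f (l + 1)‖])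
      rw [dist_comm (f (l + 2)), dist_eq_norm (f (m + 2))] at htri
      rw [dist_eq_norm]
      linarith
    refine ⟨(f (m + 2), f (l + 2), f (l + 1), f 0), ⟨m3, m2, m1, m0⟩,
      ⟨n23.symm, n13.symm, n03.symm, n12.symm, n02.symm, n01.symm⟩, ⟨?_, ?_⟩, ?_, ?_⟩
    · dsimp only
      rwa [EuclideanGeometry.angle_comm]
    · dsimp only
      rwa [EuclideanGeometry.angle_comm]
    · dsimp only
      rwa [dist_comm (f (m + 2)) (f 0)]
    · dsimp only
      rw [dist_comm (f (l + 2))]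
      nlinarith

/-- A large finite set contains a flat quadruple of length more than `s`, or many points at
mutual distance at most `ε * s`. -/
theorem exists_isFlatQuadruple_or_cluster (d : ℕ) (ε : ℝ) (hε0 : 0 < ε) (hε1 : ε < 1) (n : ℕ) :
    ∃ N : ℕ, ∀ W : Finset (Euc d), N ≤ W.card → ∀ s : ℝ, 0 < s →
      (∃ q, IsFlatQuadruple ε W q ∧ s < dist q.1 q.2.2.2) ∨
      ∃ W' ⊆ W, n ≤ W'.card ∧ ∀ x ∈ W', ∀ y ∈ W', dist x y ≤ ε * s := by
  classical
  obtain ⟨N₀, hN₀⟩ := exists_isFlatQuadruple d ε hε0 hε1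
  obtain ⟨T, hT⟩ := exists_finite_unit_cover d (ε / 2) (by positivity)
  refine ⟨N₀ * T.card * n + 1, fun W hW s hs => or_iff_not_imp_left.mpr fun hno => ?_⟩
  obtain ⟨S, hS, hmax⟩ := Finset.exists_max_image
    (W.powerset.filter fun S => ∀ x ∈ S, ∀ y ∈ S, x ≠ y → s < dist x y) Finset.card
    ⟨∅, by simp⟩
  rw [Finset.mem_filter, Finset.mem_powerset] at hS
  obtain ⟨hSW, hsep⟩ := hS
  have hScard : S.card ≤ N₀ := by
    by_contra! h
    obtain ⟨q, hq⟩ := hN₀ S h.le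
    exact hno ⟨q, hq.mono hSW, hsep _ hq.1.1 _ hq.1.2.2.2 hq.2.1.2.2.1⟩
  have hnear : ∀ w ∈ W, ∃ p ∈ S, dist w p ≤ s := by
    intro w hw
    by_contra! h
    have hwS : w ∉ S := fun hwS => by
      have := h w hwS
      rw [dist_self] at this
      linarith
    have := hmax (insert w S) (by
      rw [Finset.mem_filter, Finset.mem_powerset]
      refine ⟨Finset.insert_subset hw hSW, fun x hx y hy hxy => ?_⟩
      rcases Finset.mem_insert.mp hx with rfl | hx' <;>
        rcases Finset.mem_insert.mp hy with rfl | hy'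
      · exact absurd rfl hxy
      · exact h y hy'
      · rw [dist_comm]; exact h x hx'
      · exact hsep x hx' y hy' hxy)
    rw [Finset.card_insert_of_notMem hwS] at this
    omega
  have hcell : ∀ w ∈ W, ∃ p ∈ S ×ˢ T, dist w (p.1 + s • p.2) ≤ ε / 2 * s := by
    intro w hw
    obtain ⟨p, hp, hwp⟩ := hnear w hw
    obtain ⟨t, ht, hdt⟩ := hT (s⁻¹ • (w - p)) (by
      rw [norm_smul, norm_inv, Real.norm_of_nonneg hs.le, ← dist_eq_norm, inv_mul_le_iff₀ hs]
      linarith)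
    refine ⟨(p, t), Finset.mk_mem_product hp ht, ?_⟩
    have : w - (p + s • t) = s • (s⁻¹ • (w - p) - t) := by
      rw [smul_sub, smul_inv_smul₀ hs.ne']
      abel
    rw [dist_eq_norm, this, norm_smul, Real.norm_of_nonneg hs.le, ← dist_eq_norm, mul_comm]
    gcongr
  choose! g hg hgd using hcell
  obtain ⟨p, -, hp⟩ := Finset.exists_lt_card_fiber_of_mul_lt_card_of_maps_to (n := n) hg (by
    rw [Finset.card_product]
    have : S.card * T.card * n ≤ N₀ * T.card * n := by gcongr
    omega)
  refine ⟨W.filter fun w => g w = p, Finset.filter_subset _ _, hp.le, fun x hx y hy => ?_⟩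
  rw [Finset.mem_filter] at hx hy
  have h1 := hgd x hx.1
  have h2 := hgd y hy.1
  rw [hx.2] at h1
  rw [hy.2] at h2
  have := dist_triangle_right x y (p.1 + s • p.2)
  linarith

/-- From large finite sets one can select flat quadruples whose lengths, in a suitable order of
the sets, decrease by a factor `ε` at each step. -/
theorem exists_isFlatQuadruple_chain (d : ℕ) (ε : ℝ) (hε0 : 0 < ε) (hε1 : ε < 1) (ι : Type*)
    (k : ℕ) : ∃ N : ℕ, ∀ (I : Finset ι) (P : ι → Finset (Euc d)), I.card = k →
      (∀ i ∈ I, N ≤ (P i).card) →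
      ∃ (σ : Fin k → ι) (q : Fin k → Euc d × Euc d × Euc d × Euc d), Function.Injective σ ∧
        (∀ i, σ i ∈ I) ∧ (∀ i, IsFlatQuadruple ε (P (σ i)) (q i)) ∧
        ∀ i j : Fin k, (j : ℕ) = (i : ℕ) + 1 →
          dist (q j).1 (q j).2.2.2 ≤ ε * dist (q i).1 (q i).2.2.2 := by
  classical
  induction k with
  | zero =>
    exact ⟨0, fun I P _ _ => ⟨Fin.elim0, Fin.elim0, fun i => i.elim0, fun i => i.elim0,
      fun i => i.elim0, fun i => i.elim0⟩⟩
  | succ k ih =>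
    obtain ⟨n, hn⟩ := ih
    obtain ⟨N₀, hN₀⟩ := exists_isFlatQuadruple d ε hε0 hε1
    obtain ⟨N₁, hN₁⟩ := exists_isFlatQuadruple_or_cluster d ε hε0 hε1 n
    refine ⟨max N₀ N₁, fun I P hI hP => ?_⟩
    let U := I.biUnion P
    obtain ⟨⟨i₀, q₀⟩, hmem, hmax⟩ := Finset.exists_max_image
      ((I ×ˢ U ×ˢ U ×ˢ U ×ˢ U).filter fun z => IsFlatQuadruple ε (P z.1) z.2)
      (fun z => dist z.2.1 z.2.2.2.2) (by
        obtain ⟨i, hi⟩ : I.Nonempty := Finset.card_pos.mp (by omega)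
        obtain ⟨q, hq⟩ := hN₀ (P i) ((le_max_left _ _).trans (hP i hi))
        refine ⟨(i, q), ?_⟩
        have hU := Finset.subset_biUnion_of_mem P hi
        simp only [Finset.mem_filter, Finset.mem_product]
        exact ⟨⟨hi, hU hq.1.1, hU hq.1.2.1, hU hq.1.2.2.1, hU hq.1.2.2.2⟩, hq⟩)
    simp only [Finset.mem_filter, Finset.mem_product] at hmem hmax
    obtain ⟨⟨hi₀, -⟩, hq₀⟩ := hmem
    set s := dist q₀.1 q₀.2.2.2 with hs
    have hs0 : 0 < s := dist_pos.mpr hq₀.2.1.2.2.1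
    have hsub : ∀ i ∈ I, ∃ W' ⊆ P i, n ≤ W'.card ∧ ∀ x ∈ W', ∀ y ∈ W', dist x y ≤ ε * s := by
      intro i hi
      refine (hN₁ (P i) ((le_max_right _ _).trans (hP i hi)) s hs0).resolve_left ?_
      rintro ⟨q, hq, hlt⟩
      have hU := Finset.subset_biUnion_of_mem P hi
      exact absurd (hmax (i, q)
        ⟨⟨hi, hU hq.1.1, hU hq.1.2.1, hU hq.1.2.2.1, hU hq.1.2.2.2⟩, hq⟩) (not_le.mpr hlt)
    choose! P' hP'sub hP'card hP'dist using hsub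
    obtain ⟨σ, q, hσ, hσI, hq, hchain⟩ := hn (I.erase i₀) P'
      (by rw [Finset.card_erase_of_mem hi₀]; omega)
      (fun i hi => hP'card i (Finset.mem_of_mem_erase hi))
    have hσI' : ∀ i, σ i ∈ I := fun i => Finset.mem_of_mem_erase (hσI i)
    refine ⟨Fin.cons i₀ σ, Fin.cons q₀ q, ?_, ?_, ?_, ?_⟩
    · rw [Fin.cons_injective_iff]
      refine ⟨?_, hσ⟩
      rintro ⟨i, hi⟩
      exact Finset.ne_of_mem_erase (hσI i) hi
    · intro i
      cases i using Fin.cases with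
      | zero => simpa using hi₀
      | succ i => simpa using hσI' i
    · intro i
      cases i using Fin.cases with
      | zero => simpa using hq₀
      | succ i => simpa using (hq i).mono (hP'sub _ (hσI' i))
    · intro i j hij
      cases j using Fin.cases with
      | zero => simp at hij
      | succ j =>
        cases i using Fin.cases with
        | zero =>
          simpa using hP'dist _ (hσI' j) _ (hq j).1.1 _ (hq j).1.2.2.2
        | succ i => simpa using hchain i j (by simpa using hij)

theorem stmt10 (k d : ℕ) (hk : 1 ≤ k) (ε : ℝ) (hε0 : 0 < ε) (hε1 : ε < 1) :
    ∃ N : ℕ, ∀ (V : Finset (Euc d)) (P : Fin k → Finset (Euc d)),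
      (∀ i, P i ⊆ V) → (∀ i, (P i).card = N) →
      (∀ i j, i ≠ j → Disjoint (P i) (P j)) →
      (∀ i j, i ≠ j → ∀ p ∈ P i, ∀ q ∈ P j, IsDoubleNormalPair V p q) →
      ∃ (σ : Equiv.Perm (Fin k)) (A a b C : Fin k → Euc d),
        (∀ i, A i ∈ P (σ i) ∧ a i ∈ P (σ i) ∧ b i ∈ P (σ i) ∧ C i ∈ P (σ i)) ∧
        (∀ i, A i ≠ a i ∧ A i ≠ b i ∧ A i ≠ C i ∧ a i ≠ b i ∧ a i ≠ C i ∧ b i ≠ C i) ∧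
        (∀ i, Real.pi - ε ≤ EuclideanGeometry.angle (A i) (a i) (b i) ∧
              Real.pi - ε ≤ EuclideanGeometry.angle (a i) (b i) (C i)) ∧
        (∀ i j : Fin k, (j : ℕ) = (i : ℕ) + 1 →
          dist (A j) (C j) ≤ ε * dist (A i) (C i)) ∧
        (∀ i, (1 / 2) * dist (A i) (C i) ≤ dist (A i) (b i)) ∧
        (∀ i, dist (a i) (b i) ≤ ε * dist (A i) (b i)) := by
  obtain ⟨N, hN⟩ := exists_isFlatQuadruple_chain d ε hε0 hε1 (Fin k) k
  refine ⟨N, fun V P _ hcard _ _ => ?_⟩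
  obtain ⟨σ, q, hσ, -, hq, hchain⟩ := hN Finset.univ P (by simp) (fun i _ => (hcard i).ge)
  exact ⟨Equiv.ofBijective σ (Finite.injective_iff_bijective.mp hσ), fun i => (q i).1,
    fun i => (q i).2.1, fun i => (q i).2.2.1, fun i => (q i).2.2.2, fun i => (hq i).1,
    fun i => (hq i).2.1, fun i => (hq i).2.2.1, hchain, fun i => (hq i).2.2.2.1,
    fun i => (hq i).2.2.2.2⟩
end

section
/- For every natural number d ≥ 2 there exists r ∈ ℕ such that no finite set V of points in Euclidean space ℝ^d contains d pairwise disjoint subsets V₁, …, V_d, each of cardinality r, with the property that any two points lying in different subsets form a double-normal pair of V. (Equivalently, k(d) ≤ d − 1.) -/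
open scoped RealInnerProductSpace

/-- Two real numbers differ by a factor of at least `K`. -/
def FarApart (K s t : ℝ) : Prop := K * s ≤ t ∨ K * t ≤ s

/-- Nonzero vectors with small pairwise normalised inner products are linearly independent. -/
lemma linearIndependent_of_almost_orthogonal {E ι : Type*} [NormedAddCommGroup E]
    [InnerProductSpace ℝ E] [Fintype ι] {K : ℝ} (hK : (Fintype.card ι : ℝ) ≤ K) (v : ι → E)
    (hv : ∀ i, v i ≠ 0)
    (h : ∀ i j, i ≠ j → K * |⟪v i, v j⟫| ≤ ‖v i‖ * ‖v j‖) : LinearIndependent ℝ v := by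
  classical
  rw [Fintype.linearIndependent_iff]
  intro g hg
  by_contra! hne
  obtain ⟨i₀, hi₀⟩ := hne
  obtain ⟨m, -, hm⟩ := Finset.exists_max_image Finset.univ (fun i => |g i| * ‖v i‖)
    ⟨i₀, Finset.mem_univ _⟩
  set A := |g m| * ‖v m‖ with hA
  have hApos : 0 < A := lt_of_lt_of_le
    (mul_pos (abs_pos.2 hi₀) (norm_pos_iff.2 (hv i₀))) (hm i₀ (Finset.mem_univ _))
  have hvm : 0 < ‖v m‖ := norm_pos_iff.2 (hv m)
  have hKpos : 0 < K := lt_of_lt_of_le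
    (by exact_mod_cast Fintype.card_pos_iff.2 ⟨m⟩) hK
  have h0 : ∑ i, g i * ⟪v i, v m⟫ = 0 := by
    have := congrArg (fun x => ⟪x, v m⟫) hg
    simpa [sum_inner, inner_smul_left] using this
  rw [← Finset.add_sum_erase _ _ (Finset.mem_univ m)] at h0
  have h1 : A * ‖v m‖ ≤ ∑ i ∈ Finset.univ.erase m, |g i * ⟪v i, v m⟫| := by
    have e : |g m * ⟪v m, v m⟫| = A * ‖v m‖ := by
      rw [real_inner_self_eq_norm_sq, abs_mul, abs_of_nonneg (sq_nonneg ‖v m‖)]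
      rw [hA]; ring
    rw [← e, eq_neg_of_add_eq_zero_left h0, abs_neg]
    exact Finset.abs_sum_le_sum_abs _ _
  have h2 : ∀ i ∈ Finset.univ.erase m, K * |g i * ⟪v i, v m⟫| ≤ A * ‖v m‖ := by
    intro i hi
    have e1 := h i m (Finset.ne_of_mem_erase hi)
    have e2 := hm i (Finset.mem_univ _)
    calc K * |g i * ⟪v i, v m⟫| = |g i| * (K * |⟪v i, v m⟫|) := by rw [abs_mul]; ring
      _ ≤ |g i| * (‖v i‖ * ‖v m‖) := by gcongr
      _ = |g i| * ‖v i‖ * ‖v m‖ := by ring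
      _ ≤ A * ‖v m‖ := by gcongr
  have h3 := Finset.sum_le_sum h2
  rw [← Finset.mul_sum, Finset.sum_const, Finset.card_erase_of_mem (Finset.mem_univ m),
    nsmul_eq_mul, Finset.card_univ, Nat.cast_sub (Fintype.card_pos_iff.2 ⟨m⟩)] at h3
  have h4 : K * (A * ‖v m‖) ≤ (Fintype.card ι - (1 : ℕ)) * (A * ‖v m‖) :=
    (mul_le_mul_of_nonneg_left h1 hKpos.le).trans h3
  have h5 : 0 < A * ‖v m‖ := mul_pos hApos hvm
  push_cast at h4
  nlinarith

/-- Vectors of very different lengths, each having inner product at most its squared length with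
every longer one, are linearly independent. -/
lemma card_le_of_farApart {d : ℕ} {ι : Type*} [Fintype ι] {K : ℝ} (v : ι → Euc d)
    (hK : (Fintype.card ι : ℝ) ≤ K) (hv : ∀ i, v i ≠ 0)
    (hfar : ∀ i j, i ≠ j → FarApart K ‖v i‖ ‖v j‖)
    (h : ∀ i j, i ≠ j → K * ‖v i‖ ≤ ‖v j‖ → |⟪v i, v j⟫| ≤ ‖v i‖ ^ 2) :
    Fintype.card ι ≤ d := by
  have key : ∀ i j, i ≠ j → K * ‖v i‖ ≤ ‖v j‖ → K * |⟪v i, v j⟫| ≤ ‖v i‖ * ‖v j‖ := by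
    intro i j hij hle
    have hKpos : 0 ≤ K := le_trans (Nat.cast_nonneg _) hK
    calc K * |⟪v i, v j⟫| ≤ K * ‖v i‖ ^ 2 := by gcongr; exact h i j hij hle
      _ = ‖v i‖ * (K * ‖v i‖) := by ring
      _ ≤ _ := by gcongr
  have hli := linearIndependent_of_almost_orthogonal hK v hv (by
    intro i j hij
    rcases hfar i j hij with hle | hle
    · exact key i j hij hle
    · rw [real_inner_comm, mul_comm ‖v i‖]
      exact key j i hij.symm hle)
  simpa using hli.fintype_card_le_finrank

/-- A large bounded set has a large subset of much smaller diameter. -/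
lemma exists_subset_small_diam (d : ℕ) {K : ℝ} (hK : 0 < K) :
    ∃ C : ℕ, ∀ (N : ℕ) (S : Finset (Euc d)) (D : ℝ), 0 < D → S.Nonempty →
      (∀ x ∈ S, ∀ y ∈ S, dist x y ≤ D) → C * N ≤ S.card →
      ∃ S' ⊆ S, N ≤ S'.card ∧ ∀ x ∈ S', ∀ y ∈ S', dist x y * K ≤ D := by
  classical
  have hε : 0 < 1 / (2 * K) := by positivity
  obtain ⟨t, -, htfin, ht⟩ := totallyBounded_iff_subset.1
    (isCompact_closedBall (0 : Euc d) 1).totallyBounded _ (Metric.dist_mem_uniformity hε)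
  lift t to Finset (Euc d) using htfin
  refine ⟨t.card, fun N S D hD hS hdiam hcard => ?_⟩
  obtain ⟨x₀, hx₀⟩ := hS
  have hcov : ∀ x ∈ S, ∃ y ∈ t, dist (D⁻¹ • (x - x₀)) y < 1 / (2 * K) := by
    intro x hx
    have : D⁻¹ • (x - x₀) ∈ Metric.closedBall (0 : Euc d) 1 := by
      rw [mem_closedBall_zero_iff, norm_smul, ← dist_eq_norm, Real.norm_eq_abs,
        abs_of_pos (inv_pos.2 hD), inv_mul_le_iff₀ hD, mul_one]
      exact hdiam x hx x₀ hx₀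
    simpa using ht this
  choose! f hft hf using hcov
  obtain ⟨y, hy, hcy⟩ := Finset.exists_le_card_fiber_of_mul_le_card_of_maps_to hft
    ⟨_, hft x₀ hx₀⟩ hcard
  refine ⟨_, Finset.filter_subset _ _, hcy, fun a ha b hb => ?_⟩
  rw [Finset.mem_filter] at ha hb
  have h1 := hf a ha.1
  have h2 := hf b hb.1
  rw [ha.2] at h1
  rw [hb.2] at h2
  have h3 := dist_triangle_right (D⁻¹ • (a - x₀)) (D⁻¹ • (b - x₀)) y
  have h4 : dist (D⁻¹ • (a - x₀)) (D⁻¹ • (b - x₀)) = D⁻¹ * dist a b := by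
    rw [dist_smul₀, Real.norm_eq_abs, abs_of_pos (inv_pos.2 hD), dist_sub_right]
  rw [h4] at h3
  have h5 : D⁻¹ * dist a b ≤ 1 / K := by
    have : 1 / (2 * K) + 1 / (2 * K) = 1 / K := by field_simp; norm_num
    linarith
  rw [inv_mul_le_iff₀ hD, mul_one_div, le_div_iff₀ hK] at h5
  exact h5

/-- A large set determines a distance far apart from finitely many prescribed lengths. -/
lemma exists_dist_farApart (d : ℕ) {K : ℝ} (hK : 1 ≤ K) (n : ℕ) :
    ∃ M : ℕ, ∀ (S : Finset (Euc d)) (T : Finset ℝ), M ≤ S.card → T.card ≤ n →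
      ∃ p ∈ S, ∃ q ∈ S, p ≠ q ∧ ∀ t ∈ T, FarApart K (dist p q) t := by
  classical
  induction n with
  | zero =>
    refine ⟨2, fun S T hS hT => ?_⟩
    obtain ⟨p, hp, q, hq, hpq⟩ := Finset.one_lt_card.1 hS
    refine ⟨p, hp, q, hq, hpq, fun t ht => ?_⟩
    simp_all
  | succ n ih =>
    obtain ⟨M, hM⟩ := ih
    obtain ⟨C, hC⟩ := exists_subset_small_diam d (K := K ^ 2) (by positivity)
    refine ⟨C * M + 2, fun S T hS hT => ?_⟩
    obtain ⟨a, ha, b, hb, hab⟩ := Finset.one_lt_card.1 (show 1 < S.card by omega)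
    obtain ⟨⟨p, q⟩, hpq, hmax⟩ := Finset.exists_max_image (S ×ˢ S) (fun z => dist z.1 z.2)
      ⟨(a, b), Finset.mem_product.2 ⟨ha, hb⟩⟩
    obtain ⟨hp, hq⟩ := Finset.mem_product.1 hpq
    have hmax' : ∀ x ∈ S, ∀ y ∈ S, dist x y ≤ dist p q := fun x hx y hy =>
      hmax (x, y) (Finset.mem_product.2 ⟨hx, hy⟩)
    have hpos : 0 < dist p q := (dist_pos.2 hab).trans_le (hmax' a ha b hb)
    by_cases hT' : ∀ t ∈ T, FarApart K (dist p q) t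
    · exact ⟨p, hp, q, hq, dist_pos.1 hpos, hT'⟩
    push Not at hT'
    obtain ⟨t, ht, hfar⟩ := hT'
    obtain ⟨S', hS', hcard, hsmall⟩ := hC M S _ hpos ⟨a, ha⟩ hmax' (by omega)
    obtain ⟨x, hx, y, hy, hxy, hT''⟩ := hM S' (T.erase t) hcard
      (by rw [Finset.card_erase_of_mem ht]; omega)
    refine ⟨x, hS' hx, y, hS' hy, hxy, fun s hs => ?_⟩
    by_cases hst : s = t
    · subst hst
      left
      have h1 := hsmall x hx y hy
      have h2 : dist p q < K * s := not_le.1 fun h => hfar (Or.inr h)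
      have h3 : K * (K * dist x y) ≤ K * s := by nlinarith
      exact le_of_mul_le_mul_left h3 (by linarith)
    · exact hT'' s (Finset.mem_erase.2 ⟨hst, hs⟩)

/-- In finitely many large sets one can choose one distance each, pairwise far apart. -/
lemma exists_pairs_farApart (d : ℕ) {K : ℝ} (hK : 1 ≤ K) (n : ℕ) :
    ∃ M : ℕ, ∀ W : Fin n → Finset (Euc d), (∀ i, M ≤ (W i).card) →
      ∃ p q : Fin n → Euc d, (∀ i, p i ∈ W i) ∧ (∀ i, q i ∈ W i) ∧ (∀ i, p i ≠ q i) ∧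
        ∀ i j, i ≠ j → FarApart K (dist (p i) (q i)) (dist (p j) (q j)) := by
  classical
  obtain ⟨M, hM⟩ := exists_dist_farApart d hK n
  refine ⟨M, fun W hW => ?_⟩
  suffices H : ∀ I : Finset (Fin n), ∃ p q : Fin n → Euc d, (∀ i ∈ I, p i ∈ W i) ∧
      (∀ i ∈ I, q i ∈ W i) ∧ (∀ i ∈ I, p i ≠ q i) ∧
        ∀ i ∈ I, ∀ j ∈ I, i ≠ j → FarApart K (dist (p i) (q i)) (dist (p j) (q j)) by
    obtain ⟨p, q, h⟩ := H Finset.univ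
    exact ⟨p, q, by simpa using h⟩
  intro I
  induction I using Finset.induction_on with
  | empty => exact ⟨0, 0, by simp⟩
  | insert a I ha ih =>
    obtain ⟨p, q, hp, hq, hpq, hfar⟩ := ih
    obtain ⟨x, hx, y, hy, hxy, hT⟩ := hM (W a) (I.image fun i => dist (p i) (q i)) (hW a)
      (Finset.card_image_le.trans (by simpa using Finset.card_le_univ I))
    have hT' : ∀ i ∈ I, FarApart K (dist x y) (dist (p i) (q i)) := fun i hi =>
      hT _ (Finset.mem_image_of_mem _ hi)
    have hne : ∀ i ∈ I, i ≠ a := fun i hi h => ha (h ▸ hi)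
    refine ⟨Function.update p a x, Function.update q a y, ?_, ?_, ?_, ?_⟩
    · intro i hi
      rcases Finset.mem_insert.1 hi with rfl | hi
      · simpa using hx
      · simpa [hne i hi] using hp i hi
    · intro i hi
      rcases Finset.mem_insert.1 hi with rfl | hi
      · simpa using hy
      · simpa [hne i hi] using hq i hi
    · intro i hi
      rcases Finset.mem_insert.1 hi with rfl | hi
      · simpa using hxy
      · simpa [hne i hi] using hpq i hi
    · intro i hi j hj hij
      rcases Finset.mem_insert.1 hi with rfl | hi' <;>
        rcases Finset.mem_insert.1 hj with rfl | hj'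
      · exact absurd rfl hij
      · simpa [hne j hj'] using hT' j hj'
      · simpa [hne i hi', FarApart, or_comm] using hT' i hi'
      · simpa [hne i hi', hne j hj'] using hfar i hi' j hj' hij

/-- The point `y` lies in the slab bounded by the hyperplanes through `p` and `q` orthogonal to
`p - q`. -/
def InSlab {d : ℕ} (p q y : Euc d) : Prop := 0 ≤ ⟪p - q, y - q⟫ ∧ 0 ≤ ⟪q - p, y - p⟫

lemma inSlab_left {d : ℕ} (p q : Euc d) : InSlab p q p := by
  simp [InSlab]

lemma inSlab_right {d : ℕ} (p q : Euc d) : InSlab p q q := by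
  simp [InSlab]

lemma InSlab.abs_inner_le {d : ℕ} {p q y z : Euc d} (hy : InSlab p q y) (hz : InSlab p q z) :
    |⟪p - q, y - z⟫| ≤ ‖p - q‖ ^ 2 := by
  have key : ∀ y, ⟪q - p, y - p⟫ = ‖p - q‖ ^ 2 - ⟪p - q, y - q⟫ := by
    intro y
    rw [← real_inner_self_eq_norm_sq, ← inner_sub_right, ← neg_sub p q, inner_neg_left,
      ← inner_neg_right]
    congr 1
    abel
  have e : ⟪p - q, y - z⟫ = ⟪p - q, y - q⟫ - ⟪p - q, z - q⟫ := by
    rw [← inner_sub_right]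
    congr 1
    abel
  obtain ⟨h1, h2⟩ := hy
  obtain ⟨h3, h4⟩ := hz
  rw [key] at h2 h4
  rw [e, abs_le]
  constructor <;> linarith

lemma IsDoubleNormalPair.inSlab {d : ℕ} {V : Finset (Euc d)} {p q y : Euc d}
    (h : IsDoubleNormalPair V p q) (hy : y ∈ V) : InSlab p q y :=
  ⟨by rw [real_inner_comm]; exact (h.2.2.2 y hy).2,
    by rw [real_inner_comm]; exact (h.2.2.2 y hy).1⟩

lemma IsDoubleNormalPair.inSlab_of_common {d : ℕ} {V : Finset (Euc d)} {p q y : Euc d}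
    (hp : IsDoubleNormalPair V p y) (hq : IsDoubleNormalPair V q y) : InSlab p q y :=
  ⟨(hq.2.2.2 p hp.2.1).1, (hp.2.2.2 q hq.2.1).1⟩

/-- Any two points from different classes form a double-normal pair. -/
def CrossDoubleNormal {d k : ℕ} (V : Finset (Euc d)) (W : Fin k → Finset (Euc d)) : Prop :=
  ∀ i j, i ≠ j → ∀ p ∈ W i, ∀ q ∈ W j, IsDoubleNormalPair V p q

lemma CrossDoubleNormal.mono {d k : ℕ} {V : Finset (Euc d)} {W W' : Fin k → Finset (Euc d)}
    (h : CrossDoubleNormal V W) (hW : ∀ i, W' i ⊆ W i) : CrossDoubleNormal V W' :=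
  fun i j hij p hp q hq => h i j hij p (hW i hp) q (hW j hq)

/-- Large classes cannot be much smaller than the distance between two of them. -/
lemma not_crossDoubleNormal_of_separated (d : ℕ) {K : ℝ} (hK : (d : ℝ) + 1 ≤ K) :
    ∃ M : ℕ, ∀ (V : Finset (Euc d)) (W : Fin d → Finset (Euc d)) (δ : ℝ),
      (∀ i, M ≤ (W i).card) → CrossDoubleNormal V W →
      (∀ i, ∀ x ∈ W i, ∀ y ∈ W i, K * dist x y ≤ δ) →
      ∀ a b, a ≠ b → (∀ x ∈ W a, ∀ y ∈ W b, δ ≤ dist x y) → False := by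
  classical
  have hK1 : 1 ≤ K := by linarith [(Nat.cast_nonneg d : (0 : ℝ) ≤ d)]
  obtain ⟨M, hM⟩ := exists_pairs_farApart d hK1 d
  refine ⟨M, fun V W δ hW hV hδ a b hab hsep => ?_⟩
  obtain ⟨p, q, hp, hq, hpq, hfar⟩ := hM W hW
  have hslab : ∀ i j, InSlab (p i) (q i) (p j) := fun i j => by
    by_cases hij : i = j
    · subst hij
      exact inSlab_left _ _
    · exact (hV i j hij _ (hp i) _ (hp j)).inSlab_of_common (hV i j hij _ (hq i) _ (hp j))
  have hslab' : ∀ i j, InSlab (p i) (q i) (q j) := fun i j => by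
    by_cases hij : i = j
    · subst hij
      exact inSlab_right _ _
    · exact (hV i j hij _ (hp i) _ (hq j)).inSlab_of_common (hV i j hij _ (hq i) _ (hq j))
  have hlong : ∀ i, K * ‖p i - q i‖ ≤ ‖p a - p b‖ := fun i => by
    rw [← dist_eq_norm, ← dist_eq_norm]
    exact (hδ i _ (hp i) _ (hq i)).trans (hsep _ (hp a) _ (hp b))
  have hDN := hV a b hab _ (hp a) _ (hp b)
  have hVp : ∀ i, p i ∈ V ∧ q i ∈ V := fun i => by
    by_cases hi : i = a
    · subst hi
      exact ⟨hDN.2.1, (hV i b hab _ (hq i) _ (hp b)).2.1⟩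
    · exact ⟨(hV i a hi _ (hp i) _ (hp a)).2.1, (hV i a hi _ (hq i) _ (hp a)).2.1⟩
  let v : Option (Fin d) → Euc d := fun o => o.elim (p a - p b) fun i => p i - q i
  have hcard := card_le_of_farApart (K := K) v (by simpa using hK) ?_ ?_ ?_
  · simp at hcard
  · rintro (_ | i)
    · exact sub_ne_zero.2 hDN.1
    · exact sub_ne_zero.2 (hpq i)
  · rintro (_ | i) (_ | j) hij
    · exact absurd rfl hij
    · exact Or.inr (hlong j)
    · exact Or.inl (hlong i)
    · simpa [v, dist_eq_norm] using hfar i j (fun h => hij (h ▸ rfl))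
  · rintro (_ | i) (_ | j) hij -
    · exact absurd rfl hij
    · exact (hDN.inSlab (hVp j).1).abs_inner_le (hDN.inSlab (hVp j).2)
    · exact (hslab i a).abs_inner_le (hslab i b)
    · exact (hslab i j).abs_inner_le (hslab' i j)

/-- Large classes have arbitrarily many distances between different classes that are pairwise
far apart. -/
lemma exists_cross_differences (d : ℕ) (hd : 2 ≤ d) {K : ℝ} (hK : (d : ℝ) + 1 ≤ K) (t : ℕ) :
    ∃ N : ℕ, ∀ (V : Finset (Euc d)) (W : Fin d → Finset (Euc d)),
      (∀ i, N ≤ (W i).card) → CrossDoubleNormal V W →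
      ∃ F : Finset (Euc d), F.card = t ∧
        (∀ v ∈ F, ∃ i j, i ≠ j ∧ ∃ p ∈ W i, ∃ q ∈ W j, v = p - q) ∧
        ∀ v ∈ F, ∀ w ∈ F, v ≠ w → FarApart K ‖v‖ ‖w‖ := by
  classical
  have hK1 : 1 < K := by
    have : (2 : ℝ) ≤ d := by exact_mod_cast hd
    linarith
  have hK0 : 0 < K := by linarith
  have : Nontrivial (Fin d) := Fin.nontrivial_iff_two_le.2 hd
  induction t with
  | zero => exact ⟨0, fun V W _ _ => ⟨∅, by simp⟩⟩
  | succ t ih =>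
    obtain ⟨N, hN⟩ := ih
    obtain ⟨M, hM⟩ := not_crossDoubleNormal_of_separated d hK
    obtain ⟨C, hC⟩ := exists_subset_small_diam d (K := 8 * K ^ 2) (by positivity)
    refine ⟨C * max N M + 1, fun V W hW hV => ?_⟩
    have hne : ∀ i, (W i).Nonempty := fun i =>
      Finset.card_pos.1 (lt_of_lt_of_le (Nat.succ_pos _) (hW i))
    obtain ⟨i₀, j₀, hij₀⟩ := exists_pair_ne (Fin d)
    let X : Finset (Euc d × Euc d) :=
      (Finset.univ.filter fun z : Fin d × Fin d => z.1 ≠ z.2).biUnion fun z => W z.1 ×ˢ W z.2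
    have hX : ∀ x y, (x, y) ∈ X ↔ ∃ i j, i ≠ j ∧ x ∈ W i ∧ y ∈ W j := by
      intro x y
      simp [X]
    obtain ⟨x₀, hx₀⟩ := hne i₀
    obtain ⟨y₀, hy₀⟩ := hne j₀
    obtain ⟨⟨p, q⟩, hpq, hmax⟩ := Finset.exists_max_image X (fun z => dist z.1 z.2)
      ⟨(x₀, y₀), (hX _ _).2 ⟨i₀, j₀, hij₀, hx₀, hy₀⟩⟩
    obtain ⟨a, b, hab, hp, hq⟩ := (hX _ _).1 hpq
    have hpos : 0 < dist p q := dist_pos.2 (hV a b hab p hp q hq).1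
    set L := dist p q with hL
    have hmax' : ∀ i j, i ≠ j → ∀ x ∈ W i, ∀ y ∈ W j, dist x y ≤ L :=
      fun i j hij x hx y hy => hmax (x, y) ((hX _ _).2 ⟨i, j, hij, hx, hy⟩)
    have hdiam : ∀ i, ∀ x ∈ W i, ∀ y ∈ W i, dist x y ≤ 2 * L := by
      intro i x hx y hy
      obtain ⟨j, hj⟩ := exists_ne i
      obtain ⟨z, hz⟩ := hne j
      have h1 := hmax' i j hj.symm x hx z hz
      have h2 := hmax' i j hj.symm y hy z hz
      linarith [dist_triangle_right x y z]
    have hsub := fun i => hC (max N M) (W i) (2 * L) (by positivity) (hne i) (hdiam i)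
      (by have := hW i; omega)
    choose W' hW' hcard hsmall using hsub
    have hV' := hV.mono hW'
    by_cases hclose : ∀ i j, i ≠ j → ∀ x ∈ W' i, ∀ y ∈ W' j, K * dist x y ≤ L
    · obtain ⟨F, hF, hcross, hfar⟩ :=
        hN V W' (fun i => (le_max_left _ _).trans (hcard i)) hV'
      have hlong : ∀ v ∈ F, K * ‖v‖ ≤ ‖p - q‖ := by
        intro v hv
        obtain ⟨i, j, hij, x, hx, y, hy, rfl⟩ := hcross v hv
        rw [← dist_eq_norm, ← dist_eq_norm]
        exact hclose i j hij x hx y hy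
      have hnot : p - q ∉ F := by
        intro hmem
        have h1 := hlong _ hmem
        rw [← dist_eq_norm, ← hL] at h1
        nlinarith
      refine ⟨insert (p - q) F, by rw [Finset.card_insert_of_notMem hnot, hF], ?_, ?_⟩
      · intro v hv
        rcases Finset.mem_insert.1 hv with rfl | hv
        · exact ⟨a, b, hab, p, hp, q, hq, rfl⟩
        · obtain ⟨i, j, hij, x, hx, y, hy, rfl⟩ := hcross v hv
          exact ⟨i, j, hij, x, hW' i hx, y, hW' j hy, rfl⟩
      · intro v hv w hw hvw
        rcases Finset.mem_insert.1 hv with rfl | hv <;> rcases Finset.mem_insert.1 hw with rfl | hw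
        · exact absurd rfl hvw
        · exact Or.inr (hlong w hw)
        · exact Or.inl (hlong v hv)
        · exact hfar v hv w hw hvw
    · exfalso
      push Not at hclose
      obtain ⟨i, j, hij, x, hx, y, hy, hxy⟩ := hclose
      have hsmall' : ∀ i, ∀ x ∈ W' i, ∀ y ∈ W' i, K * (K * dist x y) ≤ L / 4 := by
        intro i x hx y hy
        have := hsmall i x hx y hy
        nlinarith
      refine hM V W' (L / (4 * K)) (fun i => (le_max_right _ _).trans (hcard i)) hV' ?_ i j hij ?_
      · intro k z hz w hw
        rw [le_div_iff₀ (by positivity)]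
        nlinarith [hsmall' k z hz w hw]
      · intro z hz w hw
        rw [div_le_iff₀ (by positivity)]
        have hle : ∀ s : ℝ, 0 ≤ s → K * (K * s) ≤ L / 4 → K * s ≤ L / 4 := by
          intro s hs h
          nlinarith [mul_nonneg hK0.le hs]
        have h1 := hle _ dist_nonneg (hsmall' i x hx z hz)
        have h2 := hle _ dist_nonneg (hsmall' j w hw y hy)
        have h3 := dist_triangle4 x z w y
        nlinarith

theorem stmt16 (d : ℕ) (hd : 2 ≤ d) :
    ∃ r : ℕ, ¬ ContainsDNMultipartite d d r := by
  obtain ⟨N, hN⟩ := exists_cross_differences d hd (K := (d : ℝ) + 1) le_rfl (d + 1)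
  refine ⟨N, ?_⟩
  rintro ⟨V, P, -, hcard, -, hV⟩
  obtain ⟨F, hF, hcross, hfar⟩ := hN V P (fun i => (hcard i).ge) hV
  have hle := card_le_of_farApart (K := (d : ℝ) + 1) (fun v : F => (v : Euc d))
    (by simp [hF]) ?_ ?_ ?_
  · simp [hF] at hle
  · rintro ⟨v, hv⟩
    obtain ⟨i, j, hij, p, hp, q, hq, rfl⟩ := hcross v hv
    exact sub_ne_zero.2 (hV i j hij p hp q hq).1
  · rintro ⟨v, hv⟩ ⟨w, hw⟩ hvw
    exact hfar v hv w hw (fun h => hvw (Subtype.ext h))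
  · rintro ⟨v, hv⟩ ⟨w, hw⟩ - -
    obtain ⟨i, j, hij, p, hp, q, hq, rfl⟩ := hcross v hv
    obtain ⟨k, l, hkl, x, hx, y, hy, rfl⟩ := hcross w hw
    have hpq := hV i j hij p hp q hq
    have hxy := hV k l hkl x hx y hy
    exact (hpq.inSlab hxy.2.1).abs_inner_le (hpq.inSlab hxy.2.2.1)
end
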